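/- arXiv:1411.0474 — 3 statements merged into one kernel-verified Lean document; each statement's English description precedes it below -/
import Mathlib

section
/- For all integers n₁, n₂ ≥ 2, m(n₁ + n₂) ≤ m(n₁) + m(n₂) + n₁ + n₂. Equivalently: for any bi-coloured systems S₁ on n₁ points and S₂ on n₂ points, there exists a bi-coloured system S on n₁ + n₂ points with m_S ≤ m_{S₁} + m_{S₂} + n₁ + n₂. -/
/-- The red line generated by two distinct points `u` and `v` in a bi-coloured
system `(V, f)`, where `f : Finset V → Bool` colours each 3-element subset
(`true` = red, `false` = blue). -/
def redLine {V : Type*} [DecidableEq V] (f : Finset V → Bool) (u v : V) : Set V :=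
  {u, v} ∪ {p | p ≠ u ∧ p ≠ v ∧ f {u, v, p} = true}

/-- The blue line generated by two distinct points `u` and `v`. -/
def blueLine {V : Type*} [DecidableEq V] (f : Finset V → Bool) (u v : V) : Set V :=
  {u, v} ∪ {p | p ≠ u ∧ p ≠ v ∧ f {u, v, p} = false}

/-- The set of distinct red lines of the system. -/
def redLines {V : Type*} [DecidableEq V] (f : Finset V → Bool) : Set (Set V) :=
  {L | ∃ u v : V, u ≠ v ∧ L = redLine f u v}

/-- The set of distinct blue lines of the system. -/
def blueLines {V : Type*} [DecidableEq V] (f : Finset V → Bool) : Set (Set V) :=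
  {L | ∃ u v : V, u ≠ v ∧ L = blueLine f u v}

/-- `m_S(R)`, the number of distinct red lines. -/
noncomputable def numRed {V : Type*} [DecidableEq V] (f : Finset V → Bool) : ℕ :=
  (redLines f).ncard

/-- `m_S(B)`, the number of distinct blue lines. -/
noncomputable def numBlue {V : Type*} [DecidableEq V] (f : Finset V → Bool) : ℕ :=
  (blueLines f).ncard

section Singleton

variable {α β : Type*}

@[simp] theorem Finset.toLeft_singleton_inl (a : α) :
    ({.inl a} : Finset (α ⊕ β)).toLeft = {a} := by
  ext; simp

@[simp] theorem Finset.toLeft_singleton_inr (b : β) :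
    ({.inr b} : Finset (α ⊕ β)).toLeft = ∅ := by
  ext; simp

@[simp] theorem Finset.toRight_singleton_inl (a : α) :
    ({.inl a} : Finset (α ⊕ β)).toRight = ∅ := by
  ext; simp

@[simp] theorem Finset.toRight_singleton_inr (b : β) :
    ({.inr b} : Finset (α ⊕ β)).toRight = {b} := by
  ext; simp

end Singleton

open Finset in
/-- The join of two colourings: triples inside a side keep their colour, and a mixed triple
is red exactly when it has a single point on the right. -/
def joinColouring {V₁ V₂ : Type*} [DecidableEq V₁] [DecidableEq V₂]
    (f₁ : Finset V₁ → Bool) (f₂ : Finset V₂ → Bool) (T : Finset (V₁ ⊕ V₂)) : Bool :=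
  if T.toRight = ∅ then f₁ T.toLeft
  else if T.toLeft = ∅ then f₂ T.toRight
  else decide (#T.toRight = 1)

section Join

variable {V₁ V₂ : Type*} [DecidableEq V₁] [DecidableEq V₂]
  (f₁ : Finset V₁ → Bool) (f₂ : Finset V₂ → Bool)

theorem redLine_comm {V : Type*} [DecidableEq V] (f : Finset V → Bool) (u v : V) :
    redLine f u v = redLine f v u := by
  ext p
  simp only [redLine, Finset.insert_comm u v, Set.pair_comm u v, and_left_comm]

theorem blueLine_comm {V : Type*} [DecidableEq V] (f : Finset V → Bool) (u v : V) :
    blueLine f u v = blueLine f v u := by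
  ext p
  simp only [blueLine, Finset.insert_comm u v, Set.pair_comm u v, and_left_comm]

theorem redLine_join_inl_inl (a b : V₁) :
    redLine (joinColouring f₁ f₂) (.inl a) (.inl b) =
      Sum.inl '' redLine f₁ a b ∪ Set.range Sum.inr := by
  ext (p | p) <;> simp [redLine, joinColouring]

theorem redLine_join_inr_inr {a b : V₂} (h : a ≠ b) :
    redLine (joinColouring f₁ f₂) (.inr a) (.inr b) = Sum.inr '' redLine f₂ a b := by
  ext (p | p) <;> simp [redLine, joinColouring, Finset.card_pair h]

theorem redLine_join_inl_inr (a : V₁) (b : V₂) :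
    redLine (joinColouring f₁ f₂) (.inl a) (.inr b) =
      Set.range Sum.inl ∪ {.inr b} := by
  ext (p | p)
  · simp [redLine, joinColouring, em]
  · obtain rfl | hp := eq_or_ne p b
    · simp [redLine]
    · simp [redLine, joinColouring, hp, Finset.card_pair hp.symm]

theorem blueLine_join_inl_inl (a b : V₁) :
    blueLine (joinColouring f₁ f₂) (.inl a) (.inl b) = Sum.inl '' blueLine f₁ a b := by
  ext (p | p) <;> simp [blueLine, joinColouring]

theorem blueLine_join_inr_inr {a b : V₂} (h : a ≠ b) :
    blueLine (joinColouring f₁ f₂) (.inr a) (.inr b) =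
      Sum.inr '' blueLine f₂ a b ∪ Set.range Sum.inl := by
  ext (p | p) <;> simp [blueLine, joinColouring, Finset.card_pair h]

theorem blueLine_join_inl_inr (a : V₁) (b : V₂) :
    blueLine (joinColouring f₁ f₂) (.inl a) (.inr b) =
      Set.range Sum.inr ∪ {.inl a} := by
  ext (p | p)
  · simp [blueLine, joinColouring]
  · obtain rfl | hp := eq_or_ne p b
    · simp [blueLine]
    · simp [blueLine, joinColouring, hp, Finset.card_pair hp.symm]

theorem ncard_le_of_subset_images {α β γ δ : Type*} [Finite α] [Finite β] [Fintype γ]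
    {A : Set α} {B : Set β} {L : Set δ} {g : α → δ} {h : β → δ} {k : γ → δ}
    (hL : L ⊆ g '' A ∪ h '' B ∪ Set.range k) :
    L.ncard ≤ A.ncard + B.ncard + Fintype.card γ := by
  have hk : (Set.range k).ncard ≤ Fintype.card γ := by
    rw [← Set.image_univ, ← Nat.card_eq_fintype_card, ← Set.ncard_univ]
    exact Set.ncard_image_le
  calc L.ncard ≤ (g '' A ∪ h '' B ∪ Set.range k).ncard :=
        Set.ncard_le_ncard hL
          (((A.toFinite.image g).union (B.toFinite.image h)).union (Set.finite_range k))
    _ ≤ (g '' A).ncard + (h '' B).ncard + (Set.range k).ncard :=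
        (Set.ncard_union_le _ _).trans (Nat.add_le_add_right (Set.ncard_union_le _ _) _)
    _ ≤ _ := add_le_add (add_le_add Set.ncard_image_le Set.ncard_image_le) hk

theorem numRed_join_le [Fintype V₁] [Fintype V₂] :
    numRed (joinColouring f₁ f₂) ≤ numRed f₁ + numRed f₂ + Fintype.card V₂ := by
  refine ncard_le_of_subset_images (g := fun L => Sum.inl '' L ∪ Set.range Sum.inr)
    (h := fun L => Sum.inr '' L) (k := fun b => Set.range Sum.inl ∪ {.inr b}) ?_
  rintro _ ⟨a | a, b | b, hab, rfl⟩
  · exact .inl (.inl ⟨_, ⟨a, b, by simpa using hab, rfl⟩, (redLine_join_inl_inl ..).symm⟩)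
  · exact .inr ⟨b, (redLine_join_inl_inr ..).symm⟩
  · exact .inr ⟨a, by rw [redLine_comm, redLine_join_inl_inr]⟩
  · have h : a ≠ b := by simpa using hab
    exact .inl (.inr ⟨_, ⟨a, b, h, rfl⟩, (redLine_join_inr_inr f₁ f₂ h).symm⟩)

theorem numBlue_join_le [Fintype V₁] [Fintype V₂] :
    numBlue (joinColouring f₁ f₂) ≤ numBlue f₁ + numBlue f₂ + Fintype.card V₁ := by
  refine ncard_le_of_subset_images (g := fun L => Sum.inl '' L)
    (h := fun L => Sum.inr '' L ∪ Set.range Sum.inl)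
    (k := fun a => Set.range Sum.inr ∪ {.inl a}) ?_
  rintro _ ⟨a | a, b | b, hab, rfl⟩
  · exact .inl (.inl ⟨_, ⟨a, b, by simpa using hab, rfl⟩, (blueLine_join_inl_inl ..).symm⟩)
  · exact .inr ⟨a, (blueLine_join_inl_inr ..).symm⟩
  · exact .inr ⟨b, by rw [blueLine_comm, blueLine_join_inl_inr]⟩
  · have h : a ≠ b := by simpa using hab
    exact .inl (.inr ⟨_, ⟨a, b, h, rfl⟩, (blueLine_join_inr_inr f₁ f₂ h).symm⟩)

end Join

/-- For any two bi-coloured systems `S₁` on `n₁ ≥ 2` points and `S₂` on `n₂ ≥ 2`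
points, there is a bi-coloured system `S` on `n₁ + n₂` points with
`m_S ≤ m_{S₁} + m_{S₂} + n₁ + n₂`; hence `m(n₁+n₂) ≤ m(n₁)+m(n₂)+n₁+n₂`. -/
theorem stmt_5 {V₁ V₂ : Type*} [Fintype V₁] [DecidableEq V₁]
    [Fintype V₂] [DecidableEq V₂]
    (h₁ : 2 ≤ Fintype.card V₁) (h₂ : 2 ≤ Fintype.card V₂)
    (f₁ : Finset V₁ → Bool) (f₂ : Finset V₂ → Bool) :
    ∃ f : Finset (V₁ ⊕ V₂) → Bool,
      numRed f + numBlue f ≤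
        (numRed f₁ + numBlue f₁) + (numRed f₂ + numBlue f₂) +
          Fintype.card V₁ + Fintype.card V₂ := by
  have hr := numRed_join_le f₁ f₂
  have hb := numBlue_join_le f₁ f₂
  exact ⟨joinColouring f₁ f₂, by omega⟩
end

section
/- Let S be the bi-coloured system derived from a finite tree T, and let x, y, z be three distinct vertices of T such that B(xy) = B(xz). Then y and z are twins. -/
/-- Three vertices `x, y, z` of a graph are collinear if one of them lies on a
shortest path (in a tree: the unique path) between the other two, i.e.
`d(x,y) + d(y,z) = d(x,z)` for some ordering of the triple. -/
def Collin {V : Type*} (G : SimpleGraph V) (x y z : V) : Prop :=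
  G.dist x y + G.dist y z = G.dist x z ∨
  G.dist y x + G.dist x z = G.dist y z ∨
  G.dist x z + G.dist z y = G.dist x y

/-- The red line generated by two distinct vertices `u`, `v` in the bi-coloured
system derived from the graph `G`: a triple is red iff it is collinear. -/
def treeRedLine {V : Type*} (G : SimpleGraph V) (u v : V) : Set V :=
  {u, v} ∪ {p | p ≠ u ∧ p ≠ v ∧ Collin G u v p}

/-- The blue line generated by two distinct vertices `u`, `v` in the bi-coloured
system derived from the graph `G`: a triple is blue iff it is not collinear. -/
def treeBlueLine {V : Type*} (G : SimpleGraph V) (u v : V) : Set V :=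
  {u, v} ∪ {p | p ≠ u ∧ p ≠ v ∧ ¬ Collin G u v p}

/-- The set of distinct red lines of the system derived from `G`. -/
def treeRedLines {V : Type*} (G : SimpleGraph V) : Set (Set V) :=
  {L | ∃ u v : V, u ≠ v ∧ L = treeRedLine G u v}

/-- The set of distinct blue lines of the system derived from `G`. -/
def treeBlueLines {V : Type*} (G : SimpleGraph V) : Set (Set V) :=
  {L | ∃ u v : V, u ≠ v ∧ L = treeBlueLine G u v}

/-- `m_S(R)`, the number of distinct red lines of the system derived from `G`. -/
noncomputable def treeNumRed {V : Type*} (G : SimpleGraph V) : ℕ :=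
  (treeRedLines G).ncard

/-- `m_S(B)`, the number of distinct blue lines of the system derived from `G`. -/
noncomputable def treeNumBlue {V : Type*} (G : SimpleGraph V) : ℕ :=
  (treeBlueLines G).ncard

/-- Two vertices are twins if they are distinct, non-adjacent and have identical
neighbourhoods. -/
def Twins {V : Type*} (G : SimpleGraph V) (x y : V) : Prop :=
  x ≠ y ∧ ¬ G.Adj x y ∧ G.neighborSet x = G.neighborSet y

namespace SimpleGraph

variable {V : Type*} {G : SimpleGraph V}

lemma Connected.exists_adj_dist_add_one_eq (hG : G.Connected) {u v : V} (h : u ≠ v) :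
    ∃ w, G.Adj u w ∧ G.dist v w + 1 = G.dist v u := by
  obtain ⟨p, hp⟩ := hG.exists_walk_length_eq_dist u v
  cases p with
  | nil => exact absurd rfl h
  | @cons _ w _ hadj q =>
    refine ⟨w, hadj, ?_⟩
    have hq := dist_le q
    have htri := hG.dist_triangle (u := u) (v := w) (w := v)
    rw [dist_eq_one_iff_adj.mpr hadj] at htri
    rw [Walk.length_cons] at hp
    rw [dist_comm (u := v) (v := w), dist_comm (u := v) (v := u)]
    omega

/-- In a tree, at most one neighbour of a vertex is closer to a given root. -/
lemma IsTree.eq_of_adj_of_dist_lt (hG : G.IsTree) {r u v w : V} (hv : G.Adj u v) (hw : G.Adj u w)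
    (hrv : G.dist r v < G.dist r u) (hrw : G.dist r w < G.dist r u) : v = w := by
  obtain ⟨p, hp, hpl⟩ := hG.connected.exists_path_of_dist r v
  obtain ⟨q, hq, hql⟩ := hG.connected.exists_path_of_dist r w
  have not_mem : ∀ {a : V} (p : G.Walk r a), p.length = G.dist r a →
      G.dist r a < G.dist r u → u ∉ p.support := by
    classical
    intro a p hpl hlt hu
    have h₁ := dist_le (p.takeUntil u hu)
    have h₂ := p.length_takeUntil_le_length hu
    omega
  have heq := (hG.isAcyclic.subsingleton_path r u).elim
    ⟨p.concat hv.symm, hp.concat (not_mem p hpl hrv) hv.symm⟩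
    ⟨q.concat hw.symm, hq.concat (not_mem q hql hrw) hw.symm⟩
  have := congrArg (fun p : G.Path r u => p.1.penultimate) heq
  simpa using this

end SimpleGraph

open SimpleGraph

/-- If `x, y, z` are not collinear and every vertex collinear with `x, y` is collinear with `x, z`,
then `y` is a leaf, and its neighbour lies between `x` and `z`. -/
lemma exists_neighborSet_eq_singleton_of_collin_imp {V : Type*} {G : SimpleGraph V}
    (hG : G.IsTree) {x y z : V} (hxy : x ≠ y) (hn : ¬ Collin G x y z)
    (h : ∀ p, p ≠ x → p ≠ y → p ≠ z → Collin G x y p → Collin G x z p) :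
    ∃ w, G.neighborSet y = {w} ∧ w ≠ z ∧ (∀ p, p ≠ y → G.dist p y = G.dist p w + 1) ∧
      G.dist x w + G.dist w z = G.dist x z := by
  have hc := hG.connected
  have hcomm : ∀ a b, G.dist a b = G.dist b a := fun a b => dist_comm
  have hn' := hn
  simp only [Collin, not_or] at hn'
  have hyz : y ≠ z := by
    rintro rfl
    simp [Collin] at hn
  have closer : ∀ p, G.Adj y p → G.dist x p < G.dist x y := by
    intro p hp
    by_contra hlt
    have hxp : G.dist x p = G.dist x y + 1 := by
      rcases hG.dist_eq_dist_add_one_of_adj x hp with h' | h' <;> omega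
    have hyp : G.dist y p = 1 := dist_eq_one_iff_adj.mpr hp
    have hcol : Collin G x y p := Or.inl (by omega)
    have hpz : p ≠ z := by rintro rfl; exact hn hcol
    have hpx : p ≠ x := by rintro rfl; simp at hxp
    rcases h p hpx hp.ne' hpz hcol with h' | h' | h'
    · obtain ⟨q, hpq, hq⟩ := hc.exists_adj_dist_add_one_eq hpz
      have htri := hc.dist_triangle (u := x) (v := z) (w := q)
      have : y = q := hG.eq_of_adj_of_dist_lt (r := x) hp.symm hpq (by omega) (by omega)
      subst this
      have := hcomm y z
      omega
    · have h₁ := hc.dist_triangle (u := z) (v := y) (w := p)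
      have h₂ := hc.dist_triangle (u := z) (v := x) (w := y)
      have := hcomm y z
      have := hcomm x z
      have := hcomm x y
      omega
    · have h₁ := hc.dist_triangle (u := y) (v := p) (w := z)
      have h₂ := hc.dist_triangle (u := x) (v := y) (w := z)
      have := hcomm z p
      omega
  obtain ⟨w, hyw, -⟩ := hc.exists_adj_dist_add_one_eq hxy.symm
  have unique : ∀ q, G.Adj y q → q = w := fun q hq =>
    hG.eq_of_adj_of_dist_lt hq hyw (closer q hq) (closer w hyw)
  have hdist : ∀ p, p ≠ y → G.dist p y = G.dist p w + 1 := by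
    intro p hp
    obtain ⟨q, hq, hqd⟩ := hc.exists_adj_dist_add_one_eq hp.symm
    rw [← unique q hq, hqd]
  have hx := hdist x hxy
  have hz := hdist z hyz.symm
  have hyw' : G.dist y w = 1 := dist_eq_one_iff_adj.mpr hyw
  have := hcomm y z
  have := hcomm x z
  have := hcomm x y
  have := hcomm w y
  have := hcomm w z
  have := hcomm w x
  have hwz : w ≠ z := by rintro rfl; omega
  have hwx : w ≠ x := by rintro rfl; omega
  refine ⟨w, Set.ext fun q => ⟨fun hq => unique q hq, ?_⟩, hwz, hdist, ?_⟩
  · rintro rfl; exact hyw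
  · rcases h w hwx hyw.ne' hwz (Or.inr (Or.inr (by omega))) with h' | h' | h' <;> omega

/-- In the system derived from a tree, if `x, y, z` are three distinct vertices
with `B(xy) = B(xz)`, then `y` and `z` are twins. -/
theorem stmt_12 {V : Type*} [Fintype V] (G : SimpleGraph V) (hG : G.IsTree)
    (x y z : V) (hxy : x ≠ y) (hxz : x ≠ z) (hyz : y ≠ z)
    (heq : treeBlueLine G x y = treeBlueLine G x z) :
    Twins G y z := by
  have mem_iff : ∀ p, p ∈ treeBlueLine G x y ↔ p ∈ treeBlueLine G x z := fun p => by rw [heq]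
  simp only [treeBlueLine, Set.mem_union, Set.mem_insert_iff, Set.mem_singleton_iff,
    Set.mem_ofPred_eq] at mem_iff
  have hny : ¬ Collin G x y z := by
    have := mem_iff z
    tauto
  have hnz : ¬ Collin G x z y := by
    have := mem_iff y
    tauto
  obtain ⟨w, hw, hwz, hdw, hw_between⟩ :=
    exists_neighborSet_eq_singleton_of_collin_imp hG hxy hny
      fun p _ _ _ _ => by grind
  obtain ⟨v, hv, hvy, hdv, hv_between⟩ :=
    exists_neighborSet_eq_singleton_of_collin_imp hG hxz hnz
      fun p _ _ _ _ => by grind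
  have hwv : w = v := by
    rw [← hG.connected.dist_eq_zero_iff]
    have h₁ := hdw x hxy
    have h₂ := hdv x hxz
    have h₃ := hdw v hvy
    have h₄ := hdv w hwz
    have h₅ : G.dist v w = G.dist w v := dist_comm
    omega
  refine ⟨hyz, fun hadj => hwz ?_, by rw [hw, hv, hwv]⟩
  have : z ∈ G.neighborSet y := hadj
  rw [hw] at this
  exact this.symm
end

section
/- Let T be a tree on n ≥ 2 vertices and let S be the bi-coloured system derived from T. Then the number of distinct blue lines of S satisfies m_S(B) = C(b,2) + a + b·s + C(s,2), where a is the number of leaves of T having at least one twin, b = n − a, and s is the number of twin classes of T. -/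
/-- The set of leaves of `G` having at least one twin (the set `A`). -/
def twinLeaves {V : Type*} (G : SimpleGraph V) : Set V :=
  {v | (G.neighborSet v).ncard = 1 ∧ ∃ w, Twins G v w}

/-- A twin class of a graph: a maximal set of at least two pairwise twin
vertices, i.e. the set consisting of a vertex `v` having a twin together with
all twins of `v`. -/
def IsTwinClass {V : Type*} (G : SimpleGraph V) (C : Set V) : Prop :=
  ∃ v w : V, Twins G v w ∧ C = {u | u = v ∨ Twins G v u}

/-- `s`, the number of twin classes of `G`. -/
noncomputable def numTwinClasses {V : Type*} (G : SimpleGraph V) : ℕ :=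
  {C : Set V | IsTwinClass G C}.ncard

section TreeMetric

variable {V : Type*} {G : SimpleGraph V}

/-- In a tree, a vertex `u` between `p` and `v` separates every vertex from `p` or from `v`. -/
lemma dist_add_or_of_between (hG : G.IsTree) {p u v : V}
    (h : G.dist p u + G.dist u v = G.dist p v) (x : V) :
    G.dist p u + G.dist u x = G.dist p x ∨ G.dist x u + G.dist u v = G.dist x v := by
  classical
  obtain ⟨a, ha⟩ := hG.connected.exists_walk_length_eq_dist p u
  obtain ⟨b, hb⟩ := hG.connected.exists_walk_length_eq_dist u v
  obtain ⟨c, hc⟩ := hG.connected.exists_walk_length_eq_dist p x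
  obtain ⟨e, he⟩ := hG.connected.exists_walk_length_eq_dist x v
  have hab : (a.append b).IsPath :=
    (a.append b).isPath_of_length_eq_dist (by rw [SimpleGraph.Walk.length_append]; omega)
  have heq : a.append b = (c.append e).bypass :=
    (hG.existsUnique_path p v).unique hab (c.append e).bypass_isPath
  have hu : u ∈ (c.append e).support := by
    apply (c.append e).support_bypass_subset_support
    rw [← heq]
    simp
  have key : ∀ {y z : V} (w : G.Walk y z), w.length = G.dist y z → u ∈ w.support →
      G.dist y u + G.dist u z = G.dist y z := by
    intro y z w hw hmem
    have h1 := SimpleGraph.dist_le (w.takeUntil u hmem)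
    have h2 := SimpleGraph.dist_le (w.dropUntil u hmem)
    have h3 := congrArg SimpleGraph.Walk.length (w.take_spec hmem)
    rw [SimpleGraph.Walk.length_append] at h3
    have h4 := hG.connected.dist_triangle (u := y) (v := u) (w := z)
    omega
  rcases (SimpleGraph.Walk.mem_support_append_iff _ _).1 hu with hu | hu
  · exact Or.inl (key c hc hu)
  · exact Or.inr (key e he hu)

lemma exists_adj_dist_eq_add_one (hG : G.Connected) {u p : V} (h : u ≠ p) :
    ∃ w, G.Adj u w ∧ G.dist u p = G.dist w p + 1 := by
  obtain ⟨a, ha⟩ := hG.exists_walk_length_eq_dist u p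
  cases a with
  | nil => exact absurd rfl h
  | @cons _ w _ hw b =>
    refine ⟨w, hw, ?_⟩
    have h1 := SimpleGraph.dist_le b
    have h2 := hG.dist_triangle (u := u) (v := w) (w := p)
    rw [SimpleGraph.dist_eq_one_iff_adj.2 hw] at h2
    rw [SimpleGraph.Walk.length_cons] at ha
    omega

lemma not_adj_of_neighborSet_eq {x y : V} (h : G.neighborSet x = G.neighborSet y) :
    ¬ G.Adj x y := fun hxy => by
  have : y ∈ G.neighborSet y := h ▸ hxy
  exact G.loopless.irrefl y this

lemma adj_iff_of_neighborSet_eq {x y : V} (h : G.neighborSet x = G.neighborSet y) (z : V) :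
    G.Adj x z ↔ G.Adj y z := by
  simpa only [SimpleGraph.mem_neighborSet] using Set.ext_iff.1 h z

lemma twins_iff {x y : V} : Twins G x y ↔ x ≠ y ∧ G.neighborSet x = G.neighborSet y :=
  ⟨fun h => ⟨h.1, h.2.2⟩, fun h => ⟨h.1, not_adj_of_neighborSet_eq h.2, h.2⟩⟩

lemma dist_eq_of_neighborSet_eq (hG : G.Connected) {x y p : V}
    (h : G.neighborSet x = G.neighborSet y) (hx : p ≠ x) (hy : p ≠ y) :
    G.dist x p = G.dist y p := by
  have key : ∀ {x y : V}, G.neighborSet x = G.neighborSet y → p ≠ x →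
      G.dist y p ≤ G.dist x p := by
    intro x y h hx
    obtain ⟨w, hw, hd⟩ := exists_adj_dist_eq_add_one hG hx.symm
    have h1 := SimpleGraph.dist_eq_one_iff_adj.2 ((adj_iff_of_neighborSet_eq h w).1 hw)
    have := hG.dist_triangle (u := y) (v := w) (w := p)
    omega
  exact le_antisymm (key h.symm hy) (key h hx)

lemma dist_eq_two_of_neighborSet_eq (hG : G.Connected) {x y : V}
    (h : G.neighborSet x = G.neighborSet y) (hxy : x ≠ y) : G.dist x y = 2 := by
  obtain ⟨w, hw, hd⟩ := exists_adj_dist_eq_add_one hG hxy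
  rw [hd, SimpleGraph.dist_eq_one_iff_adj.2 ((adj_iff_of_neighborSet_eq h w).1 hw).symm]

lemma dist_eq_two_of_adj_adj (hG : G.IsTree) {x y z : V} (hxy : G.Adj x y) (hyz : G.Adj y z)
    (hxz : x ≠ z) : G.dist x z = 2 := by
  have h1 := SimpleGraph.dist_eq_one_iff_adj.2 hxy
  have h2 := SimpleGraph.dist_eq_one_iff_adj.2 hyz
  have h3 := hG.connected.dist_triangle (u := x) (v := y) (w := z)
  have h4 := hG.dist_ne_of_adj x hyz
  have h5 := hG.connected.pos_dist_of_ne hxz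
  omega

lemma eq_of_adj_of_twins (hG : G.IsTree) {v w x y : V} (h : Twins G v w)
    (hx : G.Adj v x) (hy : G.Adj v y) : x = y := by
  rw [twins_iff] at h
  by_contra hxy
  have hvw := dist_eq_two_of_neighborSet_eq hG.connected h.2 h.1
  have h1 := SimpleGraph.dist_eq_one_iff_adj.2 hx
  have h2 := SimpleGraph.dist_eq_one_iff_adj.2 hy
  have h3 := SimpleGraph.dist_eq_one_iff_adj.2 ((adj_iff_of_neighborSet_eq h.2 x).1 hx)
  have h4 := SimpleGraph.dist_eq_one_iff_adj.2 ((adj_iff_of_neighborSet_eq h.2 y).1 hy)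
  have h5 := dist_eq_two_of_adj_adj hG hx.symm hy hxy
  have h6 := SimpleGraph.dist_comm (G := G) (u := x) (v := v)
  have h7 := SimpleGraph.dist_comm (G := G) (u := x) (v := w)
  have h8 := SimpleGraph.dist_comm (G := G) (u := v) (v := w)
  rcases dist_add_or_of_between hG (p := x) (u := v) (v := y) (by omega) w with h | h <;> omega

lemma mem_twinLeaves_iff (hG : G.IsTree) {v : V} : v ∈ twinLeaves G ↔ ∃ w, Twins G v w := by
  refine ⟨fun h => h.2, fun ⟨w, h⟩ => ⟨?_, w, h⟩⟩
  obtain ⟨x, hx, -⟩ := exists_adj_dist_eq_add_one hG.connected h.1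
  rw [Set.ncard_eq_one]
  exact ⟨x, Set.eq_singleton_iff_unique_mem.2 ⟨hx, fun y hy => eq_of_adj_of_twins hG h hy hx⟩⟩

lemma collin_iff (u v p : V) : Collin G u v p ↔
    G.dist p u + G.dist u v = G.dist p v ∨ G.dist p v + G.dist v u = G.dist p u ∨
      G.dist u p + G.dist p v = G.dist u v := by
  have h1 := SimpleGraph.dist_comm (G := G) (u := u) (v := v)
  have h2 := SimpleGraph.dist_comm (G := G) (u := u) (v := p)
  have h3 := SimpleGraph.dist_comm (G := G) (u := v) (v := p)
  unfold Collin
  omega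

lemma mem_treeBlueLine {u v p : V} :
    p ∈ treeBlueLine G u v ↔ p = u ∨ p = v ∨ ¬ Collin G u v p := by
  simp only [treeBlueLine, Set.mem_union, Set.mem_insert_iff, Set.mem_singleton_iff,
    Set.mem_ofPred_eq]
  tauto

lemma treeBlueLine_comm (u v : V) : treeBlueLine G u v = treeBlueLine G v u := by
  ext p
  have h1 := SimpleGraph.dist_comm (G := G) (u := u) (v := v)
  have h2 := SimpleGraph.dist_comm (G := G) (u := u) (v := p)
  have h3 := SimpleGraph.dist_comm (G := G) (u := v) (v := p)
  rw [mem_treeBlueLine, mem_treeBlueLine, collin_iff, collin_iff]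
  constructor <;> rintro (h | h | h) <;> first | exact Or.inl h | exact Or.inr (Or.inl h) | skip
  all_goals right; right; omega

lemma treeBlueLine_of_adj (hG : G.IsTree) {u v : V} (h : G.Adj u v) :
    treeBlueLine G u v = {u, v} := by
  ext p
  have h1 := hG.dist_eq_dist_add_one_of_adj p h
  have h2 := SimpleGraph.dist_eq_one_iff_adj.2 h
  have h3 := SimpleGraph.dist_comm (G := G) (u := u) (v := v)
  rw [mem_treeBlueLine, collin_iff]
  simp only [Set.mem_insert_iff, Set.mem_singleton_iff]
  constructor
  · rintro (h | h | h)
    · exact Or.inl h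
    · exact Or.inr h
    · omega
  · tauto

/-- `p` lies strictly inside the path between `u` and `v`. -/
def Inside (G : SimpleGraph V) (u p v : V) : Prop :=
  p ≠ u ∧ p ≠ v ∧ G.dist u p + G.dist p v = G.dist u v

lemma Inside.symm {u p v : V} (h : Inside G u p v) : Inside G v p u := by
  refine ⟨h.2.1, h.1, ?_⟩
  have h1 := SimpleGraph.dist_comm (G := G) (u := u) (v := v)
  have h2 := SimpleGraph.dist_comm (G := G) (u := u) (v := p)
  have h3 := SimpleGraph.dist_comm (G := G) (u := v) (v := p)
  have := h.2.2
  omega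

lemma Inside.notMem {u p v : V} (h : Inside G u p v) : p ∉ treeBlueLine G u v := by
  rw [mem_treeBlueLine, collin_iff]
  have := h.2.2
  rintro (h' | h' | h')
  · exact h.1 h'
  · exact h.2.1 h'
  · omega

/-- A vertex beyond `u` is separated by `u` from every vertex of the blue line of `u` and `v`. -/
lemma dist_add_of_mem_treeBlueLine (hG : G.IsTree) {p u v x : V}
    (h : G.dist p u + G.dist u v = G.dist p v) (hx : x ∈ treeBlueLine G u v) :
    G.dist p u + G.dist u x = G.dist p x := by
  rw [mem_treeBlueLine, collin_iff] at hx
  rcases hx with rfl | rfl | hx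
  · simp
  · exact h
  · rcases dist_add_or_of_between hG h x with h' | h' <;> omega

lemma inside_iff (hG : G.IsTree) {u v p : V} :
    Inside G u p v ↔ p ∉ treeBlueLine G u v ∧ ∃ x ∈ treeBlueLine G u v,
      ∃ y ∈ treeBlueLine G u v, G.dist x p + G.dist p y = G.dist x y := by
  constructor
  · intro h
    exact ⟨h.notMem, u, mem_treeBlueLine.2 (Or.inl rfl), v,
      mem_treeBlueLine.2 (Or.inr (Or.inl rfl)), h.2.2⟩
  · have beyond : ∀ {u v x y : V}, p ≠ u → x ∈ treeBlueLine G u v → y ∈ treeBlueLine G u v →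
        G.dist x p + G.dist p y = G.dist x y → G.dist p u + G.dist u v ≠ G.dist p v := by
      intro u v x y hpu hx hy hxy h
      have h1 := dist_add_of_mem_treeBlueLine hG h hx
      have h2 := dist_add_of_mem_treeBlueLine hG h hy
      have h3 := hG.connected.pos_dist_of_ne hpu
      have h4 := hG.connected.dist_triangle (u := x) (v := u) (w := y)
      have h5 := SimpleGraph.dist_comm (G := G) (u := x) (v := p)
      have h6 := SimpleGraph.dist_comm (G := G) (u := x) (v := u)
      omega
    rintro ⟨hp, x, hx, y, hy, hxy⟩
    have h1 := beyond (u := u) (v := v) (fun h => hp (mem_treeBlueLine.2 (Or.inl h))) hx hy hxy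
    have h2 := beyond (u := v) (v := u) (fun h => hp (mem_treeBlueLine.2 (Or.inr (Or.inl h))))
      (treeBlueLine_comm u v ▸ hx) (treeBlueLine_comm u v ▸ hy) hxy
    rw [mem_treeBlueLine, collin_iff] at hp
    refine ⟨fun h => hp (Or.inl h), fun h => hp (Or.inr (Or.inl h)), ?_⟩
    by_contra h3
    exact hp (Or.inr (Or.inr (by tauto)))

lemma inside_iff_of_treeBlueLine_eq (hG : G.IsTree) {u v u' v' : V}
    (h : treeBlueLine G u v = treeBlueLine G u' v') (p : V) :
    Inside G u p v ↔ Inside G u' p v' := by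
  rw [inside_iff hG, inside_iff hG, h]

lemma exists_adj_inside (hG : G.Connected) {u v : V} (huv : u ≠ v) (h : ¬ G.Adj u v) :
    ∃ p, G.Adj u p ∧ Inside G u p v := by
  obtain ⟨p, hp, hd⟩ := exists_adj_dist_eq_add_one hG huv
  refine ⟨p, hp, hp.ne', ?_, ?_⟩
  · rintro rfl
    exact h hp
  · rw [hd, SimpleGraph.dist_eq_one_iff_adj.2 hp, add_comm]

end TreeMetric

section BlueLineEq

variable {V : Type*} {G : SimpleGraph V}

/-- An endpoint of a pair generating a blue line that is not an endpoint of another pair generating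
the same line has only one neighbour. -/
lemma eq_of_adj_of_treeBlueLine_eq (hG : G.IsTree) {u v u' v' p w : V}
    (h : treeBlueLine G u v = treeBlueLine G u' v') (hu : u' ≠ u) (hv : u' ≠ v)
    (hp : G.Adj u' p) (hpi : Inside G u' p v') (hw : G.Adj u' w) : w = p := by
  by_contra hwp
  have hwp2 := dist_eq_two_of_adj_adj hG hw.symm hp hwp
  have hp1 := SimpleGraph.dist_eq_one_iff_adj.2 hp
  have hw1 := SimpleGraph.dist_eq_one_iff_adj.2 hw.symm
  have hpi' := hpi.2.2
  have hwuv : G.dist w u' + G.dist u' v' = G.dist w v' := by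
    rcases dist_add_or_of_between hG (p := w) (u := u') (v := p) (by omega) v' with h1 | h1
    · exact h1
    · have := SimpleGraph.dist_comm (G := G) (u := v') (v := u')
      have := SimpleGraph.dist_comm (G := G) (u := v') (v := p)
      omega
  have hwB : w ∉ treeBlueLine G u' v' := by
    rw [mem_treeBlueLine, collin_iff]
    rintro (rfl | rfl | h1)
    · exact hw.ne rfl
    · have := SimpleGraph.dist_self (G := G) (v := w)
      omega
    · omega
  have hwI : ¬ Inside G u' w v' := by
    intro h1
    have := h1.2.2
    have := SimpleGraph.dist_comm (G := G) (u := w) (v := u')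
    omega
  have hu'B : u' ∈ treeBlueLine G u v := h ▸ mem_treeBlueLine.2 (Or.inl rfl)
  rw [← inside_iff_of_treeBlueLine_eq hG h] at hwI
  rw [← h] at hwB
  have beyond : ∀ {u v : V}, u' ≠ u → w ∉ treeBlueLine G u v → u' ∈ treeBlueLine G u v →
      G.dist w u + G.dist u v ≠ G.dist w v := by
    intro u v hu hwB hu'B h1
    have h2 := dist_add_of_mem_treeBlueLine hG h1 hu'B
    have h3 := hG.connected.pos_dist_of_ne hu.symm
    have h4 : w ≠ u := fun h => hwB (mem_treeBlueLine.2 (Or.inl h))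
    have h5 := hG.connected.pos_dist_of_ne h4
    omega
  have h1 := beyond hu hwB hu'B
  have h2 := beyond hv (treeBlueLine_comm u v ▸ hwB) (treeBlueLine_comm u v ▸ hu'B)
  rw [mem_treeBlueLine, collin_iff] at hwB
  exact hwI ⟨fun h => hwB (Or.inl h), fun h => hwB (Or.inr (Or.inl h)), by tauto⟩

/-- The two extreme interior vertices of a path are determined by its set of interior vertices. -/
lemma eq_or_eq_of_inside_iff (hG : G.IsTree) {u v u' v' p q p' : V}
    (h : ∀ x, Inside G u x v ↔ Inside G u' x v')
    (hp : G.Adj u p) (hpi : Inside G u p v) (hq : G.Adj v q) (hqi : Inside G u q v)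
    (hp' : G.Adj u' p') (hpi' : Inside G u' p' v') : p' = p ∨ p' = q := by
  by_contra! hne
  have order : ∀ {u v x y : V}, Inside G u x v → Inside G u y v →
      G.dist u x + G.dist x y = G.dist u y ∨ G.dist u y + G.dist x y = G.dist u x := by
    intro u v x y hx hy
    have h1 := hx.2.2
    have h2 := hy.2.2
    have h3 := SimpleGraph.dist_comm (G := G) (u := y) (v := x)
    rcases dist_add_or_of_between hG h1 y with h | h <;> omega
  have hp1 := SimpleGraph.dist_eq_one_iff_adj.2 hp
  have hq1 := SimpleGraph.dist_eq_one_iff_adj.2 hq.symm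
  have hp1' := SimpleGraph.dist_eq_one_iff_adj.2 hp'
  have hx := (h p').2 hpi'
  have e1 := order hpi hx
  have e2 := order hx.symm hqi.symm
  have e3 := order hpi' ((h p).1 hpi)
  have e4 := order hpi' ((h q).1 hqi)
  have e5 := order ((h p).1 hpi) ((h q).1 hqi)
  have e6 := order hpi hqi
  have d1 := hG.connected.pos_dist_of_ne hne.1
  have d2 := hG.connected.pos_dist_of_ne hne.2
  have c1 := SimpleGraph.dist_comm (G := G) (u := p) (v := p')
  have c2 := SimpleGraph.dist_comm (G := G) (u := v) (v := q)
  have c3 := SimpleGraph.dist_comm (G := G) (u := v) (v := p')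
  have l1 := hpi.2.2
  have l2 := hqi.2.2
  have l3 := hx.2.2
  have l4 := hG.connected.pos_dist_of_ne ((h p).1 hpi).1
  have l5 := hG.connected.pos_dist_of_ne ((h q).1 hqi).1
  have l6 := SimpleGraph.dist_comm (G := G) (u := u') (v := p)
  have l7 := SimpleGraph.dist_comm (G := G) (u := u') (v := q)
  have l8 := hG.connected.pos_dist_of_ne hx.1
  have l9 := hG.connected.pos_dist_of_ne hx.2.1
  have l10 := SimpleGraph.dist_comm (G := G) (u := u) (v := p')
  omega

lemma neighborSet_eq_of_treeBlueLine_eq (hG : G.IsTree) {u v u' v' p : V}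
    (h : treeBlueLine G u v = treeBlueLine G u' v') (hu' : u' ≠ v) (hv' : u ≠ v')
    (hp : G.Adj u p) (hpi : Inside G u p v) (hp' : G.Adj u' p) (hpi' : Inside G u' p v') :
    G.neighborSet u = G.neighborSet u' := by
  rcases eq_or_ne u u' with rfl | hne
  · rfl
  · ext w
    have h1 := eq_of_adj_of_treeBlueLine_eq hG (w := w) h hne.symm hu' hp' hpi'
    have h2 := eq_of_adj_of_treeBlueLine_eq hG (w := w) h.symm hne hv' hp hpi
    exact ⟨fun hw => h2 hw ▸ hp', fun hw => h1 hw ▸ hp⟩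

/-- Ordered pairs that agree, or that are non-adjacent and agree up to twins. -/
def SamePair (G : SimpleGraph V) (u v u' v' : V) : Prop :=
  (u = u' ∧ v = v') ∨ (¬ G.Adj u v ∧ G.neighborSet u = G.neighborSet u' ∧
    G.neighborSet v = G.neighborSet v')

lemma samePair_of_common_ends (hG : G.IsTree) {u v u' v' p q : V}
    (h : treeBlueLine G u v = treeBlueLine G u' v') (huv : ¬ G.Adj u v)
    (hp : G.Adj u p) (hpi : Inside G u p v) (hq : G.Adj v q) (hqi : Inside G u q v)
    (hp' : G.Adj u' p) (hpi' : Inside G u' p v') (hq' : G.Adj v' q) (hqi' : Inside G u' q v') :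
    SamePair G u v u' v' ∨ SamePair G u v v' u' := by
  have hB : treeBlueLine G v u = treeBlueLine G v' u' := by
    rw [treeBlueLine_comm v, treeBlueLine_comm v', h]
  have mid : ∀ {u v p q : V}, G.Adj u p → Inside G u p v → G.Adj v q → Inside G u q v →
      G.Adj v p → p = q := by
    intro u v p q hp hpi hq hqi hvp
    have h1 := SimpleGraph.dist_eq_one_iff_adj.2 hp
    have h2 := SimpleGraph.dist_eq_one_iff_adj.2 hvp.symm
    have h3 := SimpleGraph.dist_eq_one_iff_adj.2 hq.symm
    have h4 := hpi.2.2
    have h5 := hqi.2.2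
    by_contra hne
    have h6 := dist_eq_two_of_adj_adj hG hvp.symm hq hne
    rcases dist_add_or_of_between hG h4 q with h | h <;>
      have := SimpleGraph.dist_comm (G := G) (u := p) (v := q) <;> omega
  by_cases hcross : u' = v ∨ u = v'
  · have hpq : p = q := by
      rcases hcross with rfl | rfl
      · exact mid hp hpi hq hqi hp'
      · exact mid hp' hpi' hq' hqi' hp
    subst hpq
    by_cases hstraight : u = u' ∨ v = v'
    · have hne : u ≠ v := by
        rintro rfl
        have h1 := hpi.2.2
        have h2 := hG.connected.pos_dist_of_ne hpi.2.1
        have h3 := SimpleGraph.dist_self (G := G) (v := u)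
        omega
      have hne' : u' ≠ v' := by
        rintro rfl
        have h1 := hpi'.2.2
        have h2 := hG.connected.pos_dist_of_ne hpi'.2.1
        have h3 := SimpleGraph.dist_self (G := G) (v := u')
        omega
      rcases hcross with rfl | rfl <;> rcases hstraight with rfl | rfl <;> contradiction
    · push Not at hstraight
      have h' : treeBlueLine G u v = treeBlueLine G v' u' := h.trans (treeBlueLine_comm _ _)
      exact Or.inr (Or.inr ⟨huv,
        neighborSet_eq_of_treeBlueLine_eq hG h' hstraight.2.symm hstraight.1 hp hpi hq' hqi'.symm,
        neighborSet_eq_of_treeBlueLine_eq hG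
          ((treeBlueLine_comm v u).trans (h'.trans (treeBlueLine_comm _ _)))
          hstraight.1.symm hstraight.2 hq hqi.symm hp' hpi'⟩)
  · push Not at hcross
    exact Or.inl (Or.inr ⟨huv,
      neighborSet_eq_of_treeBlueLine_eq hG h hcross.1 hcross.2 hp hpi hp' hpi',
      neighborSet_eq_of_treeBlueLine_eq hG hB hcross.2.symm hcross.1.symm
        hq hqi.symm hq' hqi'.symm⟩)

lemma samePair_of_treeBlueLine_eq (hG : G.IsTree) {u v u' v' : V} (huv : u ≠ v) (huv' : u' ≠ v')
    (h : treeBlueLine G u v = treeBlueLine G u' v') :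
    SamePair G u v u' v' ∨ SamePair G u v v' u' := by
  have small : ∀ {u v u' v' : V}, u' ≠ v' → G.Adj u v →
      treeBlueLine G u v = treeBlueLine G u' v' → (u = u' ∧ v = v') ∨ (u = v' ∧ v = u') := by
    intro u v u' v' huv' hadj h
    have h1 : u' ∈ treeBlueLine G u v := h ▸ mem_treeBlueLine.2 (Or.inl rfl)
    have h2 : v' ∈ treeBlueLine G u v := h ▸ mem_treeBlueLine.2 (Or.inr (Or.inl rfl))
    rw [treeBlueLine_of_adj hG hadj] at h1 h2
    simp only [Set.mem_insert_iff, Set.mem_singleton_iff] at h1 h2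
    rcases h1 with rfl | rfl <;> rcases h2 with rfl | rfl <;> simp_all
  by_cases hadj : G.Adj u v
  · exact (small huv' hadj h).imp Or.inl Or.inl
  by_cases hadj' : G.Adj u' v'
  · refine (small huv hadj' h.symm).imp (fun e => Or.inl ⟨e.1.symm, e.2.symm⟩)
      (fun e => Or.inl ⟨e.2.symm, e.1.symm⟩)
  obtain ⟨p, hp, hpi⟩ := exists_adj_inside hG.connected huv hadj
  obtain ⟨q, hq, hqi⟩ := exists_adj_inside hG.connected huv.symm (fun h => hadj h.symm)
  obtain ⟨p', hp', hpi'⟩ := exists_adj_inside hG.connected huv' hadj'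
  obtain ⟨q', hq', hqi'⟩ := exists_adj_inside hG.connected huv'.symm (fun h => hadj' h.symm)
  replace hqi := hqi.symm
  replace hqi' := hqi'.symm
  have hI := inside_iff_of_treeBlueLine_eq hG h
  have swap : ∀ x, Inside G u x v ↔ Inside G v' x u' := fun x =>
    (hI x).trans ⟨Inside.symm, Inside.symm⟩
  have swap' : ∀ x, Inside G u' x v' ↔ Inside G v x u := fun x =>
    (hI x).symm.trans ⟨Inside.symm, Inside.symm⟩
  have e1 := eq_or_eq_of_inside_iff hG hI hp hpi hq hqi hp' hpi'
  have e2 := eq_or_eq_of_inside_iff hG swap hp hpi hq hqi hq' hqi'.symm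
  have e3 := eq_or_eq_of_inside_iff hG (fun x => (hI x).symm) hp' hpi' hq' hqi' hp hpi
  have e4 := eq_or_eq_of_inside_iff hG swap' hp' hpi' hq' hqi' hq hqi.symm
  have e : (p' = p ∧ q' = q) ∨ (p' = q ∧ q' = p) := by grind
  rcases e with ⟨rfl, rfl⟩ | ⟨rfl, rfl⟩
  · exact samePair_of_common_ends hG h hadj hp hpi hq hqi hp' hpi' hq' hqi'
  · exact (samePair_of_common_ends hG (h.trans (treeBlueLine_comm _ _)) hadj hp hpi hq hqi
      hq' hqi'.symm hp' hpi'.symm).symm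

lemma treeBlueLine_of_neighborSet_eq (hG : G.IsTree) {u v : V} (huv : u ≠ v)
    (h : G.neighborSet u = G.neighborSet v) :
    treeBlueLine G u v = {p | ¬ G.Adj u p} := by
  ext p
  rw [mem_treeBlueLine, collin_iff, Set.mem_ofPred_eq]
  by_cases hu : p = u
  · simp [hu]
  by_cases hv : p = v
  · simp [hv, not_adj_of_neighborSet_eq h]
  have h1 := dist_eq_two_of_neighborSet_eq hG.connected h huv
  have h2 := dist_eq_of_neighborSet_eq hG.connected h hu hv
  have h3 := SimpleGraph.dist_comm (G := G) (u := u) (v := v)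
  have h4 := SimpleGraph.dist_comm (G := G) (u := u) (v := p)
  have h5 := SimpleGraph.dist_comm (G := G) (u := v) (v := p)
  rw [← SimpleGraph.dist_eq_one_iff_adj]
  simp only [hu, hv, false_or]
  omega

lemma treeBlueLine_congr_left (hG : G.IsTree) {u u' v : V} (huv : u ≠ v) (huv' : u' ≠ v)
    (hadj : ¬ G.Adj u v) (h : G.neighborSet u = G.neighborSet u') :
    treeBlueLine G u v = treeBlueLine G u' v := by
  rcases eq_or_ne u u' with rfl | hne
  · rfl
  have hd := dist_eq_of_neighborSet_eq hG.connected h huv.symm huv'.symm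
  have h2 := dist_eq_two_of_neighborSet_eq hG.connected h hne
  have h3 := hG.connected.pos_dist_of_ne huv
  have h4 : G.dist u v ≠ 1 := fun h => hadj (SimpleGraph.dist_eq_one_iff_adj.1 h)
  have c1 := SimpleGraph.dist_comm (G := G) (u := u) (v := v)
  have c2 := SimpleGraph.dist_comm (G := G) (u := u') (v := v)
  have c3 := SimpleGraph.dist_comm (G := G) (u := u') (v := u)
  ext p
  rw [mem_treeBlueLine, mem_treeBlueLine, collin_iff, collin_iff]
  by_cases hu : p = u
  · subst hu
    simp only [true_or, true_iff]
    right; right; omega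
  by_cases hu' : p = u'
  · subst hu'
    simp only [true_or, iff_true]
    right; right; omega
  have hp := dist_eq_of_neighborSet_eq hG.connected h hu hu'
  have c4 := SimpleGraph.dist_comm (G := G) (u := u) (v := p)
  have c5 := SimpleGraph.dist_comm (G := G) (u := u') (v := p)
  by_cases hv : p = v
  · simp [hv]
  simp only [hu, hu', hv, false_or]
  omega

lemma SamePair.treeBlueLine_eq (hG : G.IsTree) {u v u' v' : V} (huv : u ≠ v) (huv' : u' ≠ v')
    (h : SamePair G u v u' v') : treeBlueLine G u v = treeBlueLine G u' v' := by
  rcases h with ⟨rfl, rfl⟩ | ⟨hadj, hu, hv⟩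
  · rfl
  by_cases htw : G.neighborSet u = G.neighborSet v
  · rw [treeBlueLine_of_neighborSet_eq hG huv htw,
      treeBlueLine_of_neighborSet_eq hG huv' (hu.symm.trans (htw.trans hv))]
    ext p
    rw [Set.mem_ofPred_eq, Set.mem_ofPred_eq, adj_iff_of_neighborSet_eq hu]
  · have hne : u' ≠ v := fun e => htw (hu.trans (congrArg _ e))
    rw [treeBlueLine_congr_left hG huv hne hadj hu, treeBlueLine_comm u',
      treeBlueLine_congr_left hG hne.symm huv'.symm _ hv, treeBlueLine_comm]
    rw [G.adj_comm, ← adj_iff_of_neighborSet_eq hu]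
    exact hadj

end BlueLineEq

section Counting

variable {V : Type*} {G : SimpleGraph V}

/-- A choice of one vertex in each class of vertices with the same neighbourhood. -/
lemma exists_twin_representatives (G : SimpleGraph V) : ∃ r : V → V,
    (∀ x, G.neighborSet (r x) = G.neighborSet x) ∧
      ∀ x y, G.neighborSet x = G.neighborSet y → r x = r y := by
  by_cases hV : Nonempty V
  · exact ⟨fun x => Function.invFun G.neighborSet (G.neighborSet x),
      fun x => Function.invFun_eq ⟨x, rfl⟩, fun x y h => by simp only [h]⟩
  · exact ⟨id, fun x => rfl, fun x => (hV ⟨x⟩).elim⟩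

variable {r : V → V}

lemma mem_twinLeaves_of_ne (hG : G.IsTree) (hr : ∀ x, G.neighborSet (r x) = G.neighborSet x)
    {x : V} (hx : r x ≠ x) : x ∈ twinLeaves G :=
  (mem_twinLeaves_iff hG).2 ⟨r x, twins_iff.2 ⟨hx.symm, (hr x).symm⟩⟩

lemma ncard_twinClasses_eq (hG : G.IsTree) (hr : ∀ x, G.neighborSet (r x) = G.neighborSet x)
    (hr' : ∀ x y, G.neighborSet x = G.neighborSet y → r x = r y) :
    numTwinClasses G = ({x | r x = x} ∩ twinLeaves G).ncard := by
  have hclass : ∀ v, {u | u = v ∨ Twins G v u} = {u | G.neighborSet v = G.neighborSet u} := by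
    intro v
    ext u
    simp only [Set.mem_ofPred_eq, twins_iff]
    constructor
    · rintro (rfl | h)
      exacts [rfl, h.2]
    · intro h
      by_cases hu : u = v
      · exact Or.inl hu
      · exact Or.inr ⟨Ne.symm hu, h⟩
  have himage : {C : Set V | IsTwinClass G C} =
      (fun v => {u | G.neighborSet v = G.neighborSet u}) '' ({x | r x = x} ∩ twinLeaves G) := by
    ext C
    simp only [Set.mem_ofPred_eq, IsTwinClass, hclass, Set.mem_image, Set.mem_inter_iff,
      mem_twinLeaves_iff hG]
    constructor
    · rintro ⟨v, w, hvw, rfl⟩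
      refine ⟨r v, ⟨hr' _ _ (hr v), ?_⟩, by rw [hr v]⟩
      by_cases hv : r v = v
      · exact ⟨w, hv.symm ▸ hvw⟩
      · exact ⟨v, twins_iff.2 ⟨hv, hr v⟩⟩
    · rintro ⟨v, ⟨-, w, hvw⟩, rfl⟩
      exact ⟨v, w, hvw, rfl⟩
  rw [numTwinClasses, himage, Set.InjOn.ncard_image]
  intro x hx y hy hxy
  have h1 : y ∈ {u | G.neighborSet x = G.neighborSet u} := by
    have h : {u | G.neighborSet x = G.neighborSet u} = {u | G.neighborSet y = G.neighborSet u} := hxy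
    rw [h, Set.mem_ofPred_eq]
  have h2 := hr' x y h1
  have h3 : r x = x := hx.1
  have h4 : r y = y := hy.1
  rw [← h3, ← h4, h2]

lemma ncard_representatives_eq [Fintype V] (hG : G.IsTree)
    (hr : ∀ x, G.neighborSet (r x) = G.neighborSet x)
    (hr' : ∀ x y, G.neighborSet x = G.neighborSet y → r x = r y) :
    {x | r x = x}.ncard = (Fintype.card V - (twinLeaves G).ncard) + numTwinClasses G := by
  rw [ncard_twinClasses_eq hG hr hr', ← Nat.card_eq_fintype_card, ← Set.ncard_compl,
    ← Set.ncard_inter_add_ncard_sdiff_eq_ncard {x | r x = x} (twinLeaves G), add_comm]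
  congr 2
  ext x
  simp only [Set.mem_sdiff, Set.mem_ofPred_eq, Set.mem_compl_iff, and_iff_right_iff_imp]
  intro hx
  by_contra h
  exact hx (mem_twinLeaves_of_ne hG hr h)

lemma exists_twin_or_neighbor (hG : G.IsTree) (r : V → V) :
    ∃ t : V → V, ∀ x ∈ twinLeaves G,
      (r x = x → Twins G x (t x)) ∧ (r x ≠ x → G.Adj x (t x)) := by
  have : ∀ x, ∃ y, x ∈ twinLeaves G → (r x = x → Twins G x y) ∧ (r x ≠ x → G.Adj x y) := by
    intro x
    by_cases hx : x ∈ twinLeaves G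
    · by_cases hrx : r x = x
      · obtain ⟨w, hw⟩ := (mem_twinLeaves_iff hG).1 hx
        exact ⟨w, fun _ => ⟨fun _ => hw, fun h => (h hrx).elim⟩⟩
      · obtain ⟨w, hw, -⟩ := exists_adj_dist_eq_add_one hG.connected (Ne.symm hrx)
        exact ⟨w, fun _ => ⟨fun h => (hrx h).elim, fun _ => hw⟩⟩
    · exact ⟨x, fun h => (hx h).elim⟩
  choose t ht using this
  exact ⟨t, ht⟩

/-- The blue line generated by an unordered pair. -/
def blueLineOfSym2 (G : SimpleGraph V) : Sym2 V → Set V :=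
  Sym2.lift ⟨treeBlueLine G, treeBlueLine_comm⟩

variable {t : V → V}

lemma treeBlueLines_eq_union [Fintype V] [DecidableEq V] (hG : G.IsTree)
    (hr : ∀ x, G.neighborSet (r x) = G.neighborSet x)
    (hr' : ∀ x y, G.neighborSet x = G.neighborSet y → r x = r y)
    (ht : ∀ x ∈ twinLeaves G, (r x = x → Twins G x (t x)) ∧ (r x ≠ x → G.Adj x (t x))) :
    treeBlueLines G =
      blueLineOfSym2 G '' ↑(({x | r x = x} : Finset V).offDiag.image Sym2.mk.uncurry) ∪
        (fun x => treeBlueLine G x (t x)) '' twinLeaves G := by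
  have hrr : ∀ x, r (r x) = r x := fun x => hr' _ _ (hr x)
  have htne : ∀ x ∈ twinLeaves G, x ≠ t x := by
    intro x hx
    by_cases hrx : r x = x
    · exact ((ht x hx).1 hrx).1
    · exact ((ht x hx).2 hrx).ne
  have hleaf : ∀ {u v}, G.Adj u v → r u ≠ u →
      treeBlueLine G u v ∈ (fun x => treeBlueLine G x (t x)) '' twinLeaves G := by
    intro u v huv hu
    have hA := mem_twinLeaves_of_ne hG hr hu
    obtain ⟨w, hw⟩ := (mem_twinLeaves_iff hG).1 hA
    exact ⟨u, hA, by simp only [eq_of_adj_of_twins hG hw ((ht u hA).2 hu) huv]⟩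
  ext L
  constructor
  · rintro ⟨u, v, huv, rfl⟩
    by_cases htw : G.neighborSet u = G.neighborSet v
    · right
      have hA : r u ∈ twinLeaves G := by
        by_cases hu : r u = u
        · exact (mem_twinLeaves_iff hG).2 ⟨v, by rw [hu]; exact twins_iff.2 ⟨huv, htw⟩⟩
        · exact (mem_twinLeaves_iff hG).2 ⟨u, twins_iff.2 ⟨hu, hr u⟩⟩
      refine ⟨r u, hA, (SamePair.treeBlueLine_eq hG huv (htne _ hA) (Or.inr
        ⟨not_adj_of_neighborSet_eq htw, (hr u).symm, ?_⟩)).symm⟩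
      rw [← htw, ← hr u]
      exact (twins_iff.1 ((ht _ hA).1 (hrr u))).2
    · have hne : r u ≠ r v := fun h => htw (by rw [← hr u, ← hr v, h])
      by_cases hadj : G.Adj u v
      · by_cases hu : r u = u
        · by_cases hv : r v = v
          · left
            exact ⟨s(u, v), Finset.mem_coe.2 (Finset.mem_image.2
              ⟨(u, v), by simp [hu, hv, huv], rfl⟩), rfl⟩
          · right
            rw [treeBlueLine_comm]
            exact hleaf hadj.symm hv
        · exact Or.inr (hleaf hadj hu)
      · left
        exact ⟨s(r u, r v), Finset.mem_coe.2 (Finset.mem_image.2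
          ⟨(r u, r v), by simp [hrr, hne], rfl⟩),
          (SamePair.treeBlueLine_eq hG huv hne (Or.inr ⟨hadj, (hr u).symm, (hr v).symm⟩)).symm⟩
  · rintro (⟨e, he, rfl⟩ | ⟨x, hx, rfl⟩)
    · obtain ⟨⟨u, v⟩, huv, rfl⟩ := Finset.mem_image.1 (Finset.mem_coe.1 he)
      exact ⟨u, v, (Finset.mem_offDiag.1 huv).2.2, rfl⟩
    · exact ⟨x, t x, htne x hx, rfl⟩

lemma injOn_blueLineOfSym2 [Fintype V] [DecidableEq V] (hG : G.IsTree)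
    (hr' : ∀ x y, G.neighborSet x = G.neighborSet y → r x = r y) :
    Set.InjOn (blueLineOfSym2 G)
      ↑(({x | r x = x} : Finset V).offDiag.image Sym2.mk.uncurry) := by
  have key : ∀ {u v u' v'}, r u = u → r v = v → r u' = u' → r v' = v' →
      SamePair G u v u' v' → u = u' ∧ v = v' := by
    rintro u v u' v' hu hv hu' hv' (h | ⟨-, h1, h2⟩)
    · exact h
    · exact ⟨by rw [← hu, ← hu', hr' _ _ h1], by rw [← hv, ← hv', hr' _ _ h2]⟩
  intro e he e' he' h
  obtain ⟨⟨u, v⟩, huv, rfl⟩ := Finset.mem_image.1 (Finset.mem_coe.1 he)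
  obtain ⟨⟨u', v'⟩, huv', rfl⟩ := Finset.mem_image.1 (Finset.mem_coe.1 he')
  simp only [Finset.mem_offDiag, Finset.mem_filter, Finset.mem_univ, true_and] at huv huv'
  refine Sym2.eq_iff.2 ?_
  exact (samePair_of_treeBlueLine_eq hG huv.2.2 huv'.2.2 h).imp
    (key huv.1 huv.2.1 huv'.1 huv'.2.1) (key huv.1 huv.2.1 huv'.2.1 huv'.1)

lemma injOn_treeBlueLine_twinLeaves (hG : G.IsTree)
    (hr' : ∀ x y, G.neighborSet x = G.neighborSet y → r x = r y)
    (ht : ∀ x ∈ twinLeaves G, (r x = x → Twins G x (t x)) ∧ (r x ≠ x → G.Adj x (t x))) :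
    Set.InjOn (fun x => treeBlueLine G x (t x)) (twinLeaves G) := by
  have hleaf : ∀ x ∈ twinLeaves G, ∀ y ∈ twinLeaves G, ¬ G.Adj x y := by
    intro x hx y hy hxy
    obtain ⟨z, hz⟩ := (mem_twinLeaves_iff hG).1 hx
    obtain ⟨w, hw⟩ := (mem_twinLeaves_iff hG).1 hy
    have h1 : G.Adj z y := (adj_iff_of_neighborSet_eq hz.2.2 y).1 hxy
    exact hz.1 (eq_of_adj_of_twins hG hw hxy.symm h1.symm)
  intro x hx y hy hxy
  obtain ⟨hx1, hx2⟩ := ht x hx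
  obtain ⟨hy1, hy2⟩ := ht y hy
  have hlx := hleaf x hx y hy
  simp only [twins_iff] at hx1 hy1
  by_cases hrx : r x = x <;> by_cases hry : r y = y
  · obtain ⟨nx, ex⟩ := hx1 hrx
    obtain ⟨ny, ey⟩ := hy1 hry
    have : G.neighborSet x = G.neighborSet y := by
      rcases samePair_of_treeBlueLine_eq hG nx ny hxy with h | h <;>
        rcases h with ⟨rfl, h⟩ | ⟨-, h, -⟩
      exacts [rfl, h, ey.symm, h.trans ey.symm]
    rw [← hrx, ← hry, hr' _ _ this]
  · obtain ⟨nx, ex⟩ := hx1 hrx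
    have ay := hy2 hry
    rcases samePair_of_treeBlueLine_eq hG ay.ne nx hxy.symm with h | h <;>
      rcases h with ⟨h, h'⟩ | ⟨h, -⟩
    · exact h.symm
    · exact (h ay).elim
    · exact (hlx (h' ▸ ay.symm)).elim
    · exact (h ay).elim
  · obtain ⟨ny, ey⟩ := hy1 hry
    have ax := hx2 hrx
    rcases samePair_of_treeBlueLine_eq hG ax.ne ny hxy with h | h <;>
      rcases h with ⟨h, h'⟩ | ⟨h, -⟩
    · exact h
    · exact (h ax).elim
    · exact (hlx (h' ▸ ax)).elim
    · exact (h ax).elim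
  · have ax := hx2 hrx
    have ay := hy2 hry
    rcases samePair_of_treeBlueLine_eq hG ax.ne ay.ne hxy with h | h <;>
      rcases h with ⟨h, h'⟩ | ⟨h, -⟩
    · exact h
    · exact (h ax).elim
    · exact (hlx (h' ▸ ax)).elim
    · exact (h ax).elim

lemma disjoint_blueLine_images [Fintype V] [DecidableEq V] (hG : G.IsTree)
    (hr' : ∀ x y, G.neighborSet x = G.neighborSet y → r x = r y)
    (ht : ∀ x ∈ twinLeaves G, (r x = x → Twins G x (t x)) ∧ (r x ≠ x → G.Adj x (t x))) :
    Disjoint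
      (blueLineOfSym2 G '' ↑(({x | r x = x} : Finset V).offDiag.image Sym2.mk.uncurry))
      ((fun x => treeBlueLine G x (t x)) '' twinLeaves G) := by
  rw [Set.disjoint_left]
  rintro _ ⟨e, he, rfl⟩ ⟨x, hx, h⟩
  obtain ⟨⟨u, v⟩, huv, rfl⟩ := Finset.mem_image.1 (Finset.mem_coe.1 he)
  simp only [Finset.mem_offDiag, Finset.mem_filter, Finset.mem_univ, true_and] at huv
  obtain ⟨hu, hv, hne⟩ := huv
  replace h : treeBlueLine G x (t x) = treeBlueLine G u v := h
  by_cases hrx : r x = x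
  · obtain ⟨nx, ex⟩ := twins_iff.1 ((ht x hx).1 hrx)
    have : G.neighborSet u = G.neighborSet v := by
      rcases samePair_of_treeBlueLine_eq hG nx hne h with h | h <;>
        rcases h with ⟨h1, h2⟩ | ⟨-, h1, h2⟩
      · rw [← h1, ← h2, ex]
      · rw [← h1, ← h2, ex]
      · rw [← h1, ← h2, ex]
      · rw [← h1, ← h2, ex]
    exact hne (by rw [← hu, ← hv, hr' _ _ this])
  · have ax := (ht x hx).2 hrx
    rcases samePair_of_treeBlueLine_eq hG ax.ne hne h with h | h <;>
      rcases h with ⟨h1, h2⟩ | ⟨h, -⟩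
    · exact hrx (h1 ▸ hu)
    · exact h ax
    · exact hrx (h1 ▸ hv)
    · exact h ax

end Counting

/-- For a tree `T` on `n ≥ 2` vertices, the number of distinct blue lines of the
derived system is `C(b,2) + a + b·s + C(s,2)`, where `a` is the number of
leaves having at least one twin, `b = n − a`, and `s` is the number of twin
classes. -/
theorem stmt_13 {V : Type*} [Fintype V] (G : SimpleGraph V) (hG : G.IsTree)
    (hn : 2 ≤ Fintype.card V) :
    treeNumBlue G =
      Nat.choose (Fintype.card V - (twinLeaves G).ncard) 2 +
        (twinLeaves G).ncard +
        (Fintype.card V - (twinLeaves G).ncard) * numTwinClasses G +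
        Nat.choose (numTwinClasses G) 2 := by
  classical
  obtain ⟨r, hr, hr'⟩ := exists_twin_representatives G
  obtain ⟨t, ht⟩ := exists_twin_or_neighbor hG r
  rw [treeNumBlue, treeBlueLines_eq_union hG hr hr' ht,
    Set.ncard_union_eq (disjoint_blueLine_images hG hr' ht) (Set.toFinite _) (Set.toFinite _),
    Set.InjOn.ncard_image (injOn_blueLineOfSym2 hG hr'),
    Set.InjOn.ncard_image (injOn_treeBlueLine_twinLeaves hG hr' ht),
    Set.ncard_coe_finset, Sym2.card_image_offDiag, ← Set.ncard_coe_finset, Finset.coe_filter_univ,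
    ncard_representatives_eq hG hr hr', Nat.add_choose_eq]
  simp [Finset.Nat.antidiagonal_succ]
  ring
end
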